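/- arXiv:math/0201001 — 2 statements merged into one kernel-verified Lean document; each statement's English description precedes it below -/
import Mathlib

section
/- Let (M, τ) be a tracial W*-probability space, let D ⊂ B ⊂ M be von Neumann subalgebras, and let X, Y ∈ M be selfadjoint. All freeness statements are with respect to the unique trace-preserving conditional expectations. Assume that Y is free from B with amalgamation over D. Then the following are equivalent: (i) X and Y are free with amalgamation over B; (ii) B⟨X⟩ (the algebra generated by B and X) and Y are free with amalgamation over D. -/
/-!  Statement 7 (Corollary 3.8):  in a tracial `W*`-probability space, with
von Neumann subalgebras `D ⊆ B` and selfadjoint `X, Y` such that `Y` is free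
from `B` over `D`, the following are equivalent:  `X` and `Y` are free with
amalgamation over `B`; `B⟨X⟩` and `Y` are free with amalgamation over `D`.
All freeness statements are with respect to the (unique) trace-preserving
conditional expectations. -/

noncomputable section

namespace OVD

variable {M : Type*} [Ring M] [Algebra ℂ M] [StarRing M] [StarModule ℂ M]

/-- `τ` is a faithful tracial state on the complex `*`-algebra `M`
(the normality and von Neumann algebra structure of a tracial
`W*`-probability space are not used in the algebraic statement). -/
structure IsFaithfulTracialState [StarRing M] (τ : M →ₗ[ℂ] ℂ) : Prop where
  unital : τ 1 = 1
  tracial : ∀ x y, τ (x * y) = τ (y * x)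
  pos : ∀ x, 0 ≤ (τ (star x * x)).re ∧ (τ (star x * x)).im = 0
  faithful : ∀ x, τ (star x * x) = 0 → x = 0

/-- `E : M → M` is a conditional expectation onto the unital subalgebra `B`. -/
def IsCondExp (B : Subalgebra ℂ M) (E : M →ₗ[ℂ] M) : Prop :=
  E 1 = 1 ∧ (∀ x, E x ∈ B) ∧ ∀ b ∈ B, ∀ b' ∈ B, ∀ x, E (b * x * b') = b * E x * b'

/-- Freeness with amalgamation with respect to a conditional expectation `E`:
every alternating product of `E`-centered elements is `E`-centered. -/
def IsFreeWithAmalgamation {A W : Type*} [Ring A] [Algebra ℂ A]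
    [AddCommGroup W] [Module ℂ W] (E : A →ₗ[ℂ] W) (S₁ S₂ : Set A) : Prop :=
  ∀ (k : ℕ), 0 < k → ∀ (a : Fin k → A) (f : Fin k → Bool),
    (∀ j, a j ∈ (if f j then S₁ else S₂)) →
    (∀ j, E (a j) = 0) →
    (∀ (j : ℕ) (h : j + 1 < k), f ⟨j, Nat.lt_of_succ_lt h⟩ ≠ f ⟨j + 1, h⟩) →
    E ((List.ofFn a).prod) = 0

section Alternating

variable {A : Type*} [Ring A] [Algebra ℂ A]

/-- The span of the alternating products of `n + 1` factors from `P` and `Q`, the first in `P`. -/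
def altPow : ℕ → Submodule ℂ A → Submodule ℂ A → Submodule ℂ A
  | 0, P, _ => P
  | n + 1, P, Q => P * altPow n Q P

/-- The span of all nonempty alternating products from `P` and `Q` whose first factor is in `P`. -/
def alt (P Q : Submodule ℂ A) : Submodule ℂ A := ⨆ n, altPow n P Q

lemma altPow_le_alt (n : ℕ) (P Q : Submodule ℂ A) : altPow n P Q ≤ alt P Q :=
  le_iSup (fun n => altPow n P Q) n

lemma le_alt (P Q : Submodule ℂ A) : P ≤ alt P Q := altPow_le_alt 0 P Q

lemma mul_alt_le (P Q : Submodule ℂ A) : P * alt Q P ≤ alt P Q := by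
  rw [alt, Submodule.mul_iSup]
  exact iSup_le fun n => altPow_le_alt (n + 1) P Q

lemma alt_mul_le {P Q R S T : Submodule ℂ A} (hP : P * R ≤ S) (hQ : Q * R ≤ T)
    (hPT : P * T ≤ S) (hQS : Q * S ≤ T) : alt P Q * R ≤ S := by
  have key : ∀ n, altPow n P Q * R ≤ S ∧ altPow n Q P * R ≤ T := by
    intro n
    induction n with
    | zero => exact ⟨hP, hQ⟩
    | succ n ih =>
      refine ⟨?_, ?_⟩
      · rw [altPow, mul_assoc]
        exact (mul_le_mul_right ih.2 P).trans hPT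
      · rw [altPow, mul_assoc]
        exact (mul_le_mul_right ih.1 Q).trans hQS
  rw [alt, Submodule.iSup_mul]
  exact iSup_le fun n => (key n).1

lemma alt_le {P Q S T : Submodule ℂ A} (hP : P ≤ S) (hQ : Q ≤ T)
    (hPT : P * T ≤ S) (hQS : Q * S ≤ T) : alt P Q ≤ S := by
  simpa using alt_mul_le (R := 1) (by simpa using hP) (by simpa using hQ) hPT hQS

lemma alt_eq (P Q : Submodule ℂ A) : alt P Q = P ⊔ P * alt Q P := by
  refine le_antisymm (alt_le (T := Q ⊔ Q * alt P Q) le_sup_left le_sup_left ?_ ?_)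
    (sup_le (le_alt P Q) (mul_alt_le P Q))
  · exact le_sup_of_le_right (mul_le_mul' le_rfl (sup_le (le_alt _ _) (mul_alt_le _ _)))
  · exact le_sup_of_le_right (mul_le_mul' le_rfl (sup_le (le_alt _ _) (mul_alt_le _ _)))

lemma mul_alt_le_alt {P Q R : Submodule ℂ A} (h : R * P ≤ P) : R * alt P Q ≤ alt P Q := by
  rw [alt_eq, Submodule.mul_sup, ← mul_assoc]
  exact sup_le_sup h (mul_le_mul' h le_rfl)

/-- If `R ≤ Q + C`, `Q R ≤ Q + C` and `P C ≤ P`, then alternating products starting in `P` are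
stable under right multiplication by `R`. -/
lemma alt_mul_le_alt {P Q R C : Submodule ℂ A} (hR : R ≤ Q ⊔ C) (hQ : Q * R ≤ Q ⊔ C)
    (hP : P * C ≤ P) : alt P Q * R ≤ alt P Q := by
  refine alt_mul_le (T := alt Q P ⊔ C) ?_ (hQ.trans (sup_le_sup_right (le_alt _ _) _)) ?_
    ((mul_alt_le _ _).trans le_sup_left)
  · refine (mul_le_mul' le_rfl hR).trans ?_
    rw [Submodule.mul_sup]
    exact sup_le ((mul_le_mul' le_rfl (le_alt _ _)).trans (mul_alt_le _ _))
      (hP.trans (le_alt _ _))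
  · rw [Submodule.mul_sup]
    exact sup_le (mul_alt_le _ _) (hP.trans (le_alt _ _))

/-- The kernel of `E` in the subalgebra `S`. -/
def centered (S : Subalgebra ℂ A) (E : A →ₗ[ℂ] A) : Submodule ℂ A :=
  Subalgebra.toSubmodule S ⊓ LinearMap.ker E

lemma altPow_le_span (E : A →ₗ[ℂ] A) (S : Bool → Subalgebra ℂ A) (n : ℕ) (s : Bool) :
    altPow n (centered (S s) E) (centered (S !s) E) ≤
      Submodule.span ℂ {w | ∃ (a : Fin (n + 1) → A) (f : Fin (n + 1) → Bool), f 0 = s ∧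
        (∀ j, a j ∈ S (f j)) ∧ (∀ j, E (a j) = 0) ∧
        (∀ (j : ℕ) (h : j + 1 < n + 1), f ⟨j, Nat.lt_of_succ_lt h⟩ ≠ f ⟨j + 1, h⟩) ∧
        (List.ofFn a).prod = w} := by
  induction n generalizing s with
  | zero =>
    intro x hx
    refine Submodule.subset_span ⟨fun _ => x, fun _ => s, rfl, fun _ => hx.1, fun _ => hx.2, ?_, ?_⟩
    · intro j h
      omega
    · simp
  | succ n ih =>
    have h := ih (!s)
    rw [Bool.not_not] at h
    rw [altPow]
    refine (mul_le_mul' le_rfl h).trans ?_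
    nth_rewrite 1 [← Submodule.span_eq (centered (S s) E)]
    rw [Submodule.span_mul_span]
    refine Submodule.span_mono ?_
    rintro _ ⟨x, hx, _, ⟨a, f, hf, ha, hE, hne, rfl⟩, rfl⟩
    refine ⟨Fin.cons x a, Fin.cons s f, rfl, ?_, ?_, ?_, ?_⟩
    · exact Fin.cases hx.1 ha
    · exact Fin.cases hx.2 hE
    · rintro (_ | j) h
      · change s ≠ f 0
        simp [hf]
      · exact hne j (by omega)
    · simp [List.ofFn_succ]

lemma prod_mem_altPow (E : A →ₗ[ℂ] A) (S : Bool → Subalgebra ℂ A) (n : ℕ)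
    (a : Fin (n + 1) → A) (f : Fin (n + 1) → Bool) (ha : ∀ j, a j ∈ S (f j))
    (hE : ∀ j, E (a j) = 0)
    (hne : ∀ (j : ℕ) (h : j + 1 < n + 1), f ⟨j, Nat.lt_of_succ_lt h⟩ ≠ f ⟨j + 1, h⟩) :
    (List.ofFn a).prod ∈ altPow n (centered (S (f 0)) E) (centered (S !(f 0)) E) := by
  induction n with
  | zero => simpa [altPow, centered] using And.intro (ha 0) (hE 0)
  | succ n ih =>
    have h := ih (fun j => a j.succ) (fun j => f j.succ) (fun j => ha _) (fun j => hE _)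
      (fun j h => hne (j + 1) (by omega))
    have h01 : f (Fin.succ 0) = !(f 0) := by
      have : f 0 ≠ f (Fin.succ 0) := hne 0 (by omega)
      revert this
      cases f 0 <;> cases f (Fin.succ 0) <;> simp
    simp only [h01, Bool.not_not] at h
    rw [List.ofFn_succ, List.prod_cons, altPow]
    exact Submodule.mul_mem_mul ⟨ha 0, hE 0⟩ h

lemma isFreeWithAmalgamation_iff (E : A →ₗ[ℂ] A) (S₁ S₂ : Subalgebra ℂ A) :
    IsFreeWithAmalgamation E (S₁ : Set A) (S₂ : Set A) ↔
      alt (centered S₁ E) (centered S₂ E) ≤ LinearMap.ker E ∧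
        alt (centered S₂ E) (centered S₁ E) ≤ LinearMap.ker E := by
  set S : Bool → Subalgebra ℂ A := fun i => if i then S₁ else S₂ with hS
  have hmem : ∀ (i : Bool) (x : A), x ∈ (if i then (S₁ : Set A) else S₂) ↔ x ∈ S i := by
    intro i x
    cases i <;> simp [hS]
  constructor
  · intro h
    have key : ∀ s, alt (centered (S s) E) (centered (S !s) E) ≤ LinearMap.ker E := by
      refine fun s => iSup_le fun n => (altPow_le_span E S n s).trans (Submodule.span_le.2 ?_)
      rintro _ ⟨a, f, -, ha, hE, hne, rfl⟩
      exact h (n + 1) n.succ_pos a f (fun j => (hmem _ _).2 (ha j)) hE hne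
    exact ⟨key true, key false⟩
  · rintro ⟨h₁, h₂⟩ k hk a f ha hE hne
    obtain ⟨n, rfl⟩ : ∃ n, k = n + 1 := ⟨k - 1, by omega⟩
    have key := altPow_le_alt _ _ _
      (prod_mem_altPow E S n a f (fun j => (hmem _ _).1 (ha j)) hE hne)
    cases h : f 0 <;> rw [h] at key
    · exact h₂ key
    · exact h₁ key

end Alternating

section CondExp

open Subalgebra (toSubmodule)

variable {A : Type*} [Ring A] [Algebra ℂ A] {C S : Subalgebra ℂ A} {E : A →ₗ[ℂ] A}

lemma IsCondExp.map_left (hE : IsCondExp C E) {c : A} (hc : c ∈ C) (x : A) :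
    E (c * x) = c * E x := by
  simpa using hE.2.2 c hc 1 C.one_mem x

lemma IsCondExp.map_right (hE : IsCondExp C E) {c : A} (hc : c ∈ C) (x : A) :
    E (x * c) = E x * c := by
  simpa using hE.2.2 1 C.one_mem c hc x

lemma IsCondExp.map_mem (hE : IsCondExp C E) {c : A} (hc : c ∈ C) : E c = c := by
  simpa [hE.1] using hE.map_left hc 1

lemma toSubmodule_mul_ker_le (hE : IsCondExp C E) :
    toSubmodule C * LinearMap.ker E ≤ LinearMap.ker E :=
  Submodule.mul_le.2 fun _ hc _ hx => by
    rw [LinearMap.mem_ker] at hx ⊢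
    rw [hE.map_left hc, hx, mul_zero]

lemma toSubmodule_mul_centered_le (hE : IsCondExp C E) (hCS : C ≤ S) :
    toSubmodule C * centered S E ≤ centered S E :=
  Submodule.mul_le.2 fun _ hc _ hx =>
    ⟨S.mul_mem (hCS hc) hx.1, toSubmodule_mul_ker_le hE (Submodule.mul_mem_mul hc hx.2)⟩

lemma centered_mul_toSubmodule_le (hE : IsCondExp C E) (hCS : C ≤ S) :
    centered S E * toSubmodule C ≤ centered S E :=
  Submodule.mul_le.2 fun x hx c hc =>
    ⟨S.mul_mem hx.1 (hCS hc), by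
      have h : E x = 0 := hx.2
      change E (x * c) = 0
      rw [hE.map_right hc, h, zero_mul]⟩

lemma toSubmodule_le_centered_sup (hE : IsCondExp C E) (hCS : C ≤ S) :
    toSubmodule S ≤ centered S E ⊔ toSubmodule C := fun x hx => by
  rw [← sub_add_cancel x (E x)]
  refine Submodule.add_mem_sup ⟨S.sub_mem hx (hCS (hE.2.1 x)), ?_⟩ (hE.2.1 x)
  change E (x - E x) = 0
  rw [map_sub, hE.map_mem (hE.2.1 x), sub_self]

lemma IsCondExp.eq_zero [StarRing A] {τ : A →ₗ[ℂ] ℂ} (hE : IsCondExp C E)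
    (hτ : IsFaithfulTracialState τ) (hC : ∀ c ∈ C, star c ∈ C)
    (hEτ : ∀ x, τ (E x) = τ x) {x : A} (hx : ∀ c ∈ C, τ (x * c) = 0) : E x = 0 := by
  refine hτ.faithful _ ?_
  have h := hC _ (hE.2.1 x)
  rw [hτ.tracial, ← hE.map_right h, hEτ, hx _ h]

end CondExp

section Amalgamation

open Subalgebra (toSubmodule)

variable {A : Type*} [Ring A] [Algebra ℂ A] {D B P Q : Subalgebra ℂ A} {ED EB : A →ₗ[ℂ] A}

/-- Alternating products of `ED`-centered elements starting in `P` are stable under right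
multiplication by `B ≤ Q`. -/
lemma alt_centered_mul_le (hED : IsCondExp D ED) (hDB : D ≤ B) (hDP : D ≤ P) (hBQ : B ≤ Q) :
    alt (centered P ED) (centered Q ED) * toSubmodule B ≤
      alt (centered P ED) (centered Q ED) := by
  have hQ := toSubmodule_le_centered_sup hED (hDB.trans hBQ)
  refine alt_mul_le_alt (le_trans hBQ hQ) (le_trans ?_ hQ) (centered_mul_toSubmodule_le hED hDP)
  exact Submodule.mul_le.2 fun x hx b hb => Q.mul_mem hx.1 (hBQ hb)

/-- If `P` contains `D`, then `B + B (alternating products starting in P)` contains the algebra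
generated by `B` and any element of `P`. -/
lemma toSubmodule_sup_adjoin_le (hED : IsCondExp D ED) (hDB : D ≤ B) (hDP : D ≤ P) {Y : A}
    (hY : Y ∈ P) :
    toSubmodule (B ⊔ Algebra.adjoin ℂ {Y}) ≤
      toSubmodule B ⊔ toSubmodule B * alt (centered P ED) (centered B ED) := by
  set V := centered P ED
  set J := alt V (centered B ED) with hJ
  set S := toSubmodule B ⊔ toSubmodule B * J with hS
  have h1B : (1 : Submodule ℂ A) ≤ toSubmodule B := Submodule.one_le.2 B.one_mem
  have hJS : J ≤ S := le_sup_of_le_right (by simpa using mul_le_mul' h1B (le_refl J))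
  have hDS : toSubmodule D ≤ S := le_sup_of_le_left hDB
  have hBB : toSubmodule B * toSubmodule B ≤ toSubmodule B :=
    Submodule.mul_le.2 fun x hx y hy => B.mul_mem hx hy
  have hBS : toSubmodule B * S ≤ S := by
    rw [hS, Submodule.mul_sup, ← mul_assoc]
    exact sup_le_sup hBB (mul_le_mul' hBB le_rfl)
  have hBB' : centered B ED ≤ toSubmodule B := inf_le_left
  have hB'S : alt (centered B ED) V ≤ S := by
    rw [alt_eq]
    exact sup_le_sup hBB' (mul_le_mul' hBB' le_rfl)
  have hB := toSubmodule_le_centered_sup hED hDB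
  have hP := toSubmodule_le_centered_sup hED hDP
  have hVD : V * toSubmodule D ≤ V := centered_mul_toSubmodule_le hED hDP
  have hDB' := toSubmodule_mul_centered_le hED hDB
  have hVB : V * toSubmodule B ≤ J :=
    (mul_le_mul' (le_alt V (centered B ED)) le_rfl).trans
      (alt_centered_mul_le hED hDB hDP le_rfl)
  have hVV : V * V ≤ V ⊔ toSubmodule D :=
    le_trans (Submodule.mul_le.2 fun x hx y hy => P.mul_mem hx.1 hy.1) hP
  have hVJ : V * J ≤ S := by
    rw [hJ, alt_eq, Submodule.mul_sup, ← mul_assoc]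
    refine sup_le (hVV.trans (sup_le ((le_alt _ _).trans hJS) hDS)) ?_
    refine (mul_le_mul' hVV le_rfl).trans ?_
    rw [Submodule.sup_mul]
    exact sup_le ((mul_alt_le _ _).trans hJS) ((mul_alt_le_alt hDB').trans hB'S)
  have hVS : V * S ≤ S := by
    rw [hS, Submodule.mul_sup, ← mul_assoc]
    refine sup_le (hVB.trans hJS) ?_
    refine (mul_le_mul' (mul_le_mul' le_rfl hB) le_rfl).trans ?_
    rw [Submodule.mul_sup, Submodule.sup_mul, mul_assoc]
    exact sup_le (((mul_le_mul' le_rfl (mul_alt_le _ _)).trans (mul_alt_le _ _)).trans hJS)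
      ((mul_le_mul' hVD le_rfl).trans hVJ)
  have hPS : toSubmodule P * S ≤ S := by
    refine (mul_le_mul' hP le_rfl).trans ?_
    rw [Submodule.sup_mul]
    have hDB : toSubmodule D ≤ toSubmodule B := hDB
    exact sup_le hVS ((mul_le_mul' hDB le_rfl).trans hBS)
  let T : Subalgebra ℂ A :=
    { carrier := {z | ∀ s ∈ S, z * s ∈ S}
      mul_mem' := fun {x y} hx hy s hs => by
        rw [mul_assoc]
        exact hx _ (hy s hs)
      add_mem' := fun {x y} hx hy s hs => by
        rw [add_mul]
        exact S.add_mem (hx s hs) (hy s hs)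
      algebraMap_mem' := fun r s hs => by
        rw [← Algebra.smul_def]
        exact S.smul_mem r hs }
  have hT : B ⊔ Algebra.adjoin ℂ {Y} ≤ T := by
    have hBT : B ≤ T := fun b hb s hs =>
      hBS (Submodule.mul_mem_mul ((Subalgebra.mem_toSubmodule _).2 hb) hs)
    refine sup_le hBT (Algebra.adjoin_le ?_)
    rintro _ rfl s hs
    exact hPS (Submodule.mul_mem_mul ((Subalgebra.mem_toSubmodule _).2 hY) hs)
  intro z hz
  simpa using hT hz 1 (hDS D.one_mem)

/-- Alternating products starting in `P`, multiplied on the left by `B`, exhaust the `EB`-centered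
elements of the algebra generated by `B` and `Y`. -/
lemma centered_sup_adjoin_le (hED : IsCondExp D ED) (hEB : IsCondExp B EB) (hDB : D ≤ B)
    (hDP : D ≤ P) {Y : A} (hY : Y ∈ P)
    (hJ : alt (centered P ED) (centered B ED) ≤ LinearMap.ker EB) :
    centered (B ⊔ Algebra.adjoin ℂ {Y}) EB ≤
      toSubmodule B * alt (centered P ED) (centered B ED) := by
  rintro v ⟨hv, hv0⟩
  obtain ⟨b, hb, j, hj, rfl⟩ :=
    Submodule.mem_sup.1 (toSubmodule_sup_adjoin_le hED hDB hDP hY hv)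
  have hj0 : EB j = 0 := toSubmodule_mul_ker_le hEB (mul_le_mul' le_rfl hJ hj)
  change EB (b + j) = 0 at hv0
  rw [map_add, hj0, add_zero, hEB.map_mem hb] at hv0
  rwa [hv0, zero_add]

/-- Freeness over `D` of `Q ≥ B` and `P` gives freeness over `B` of `Q` and `R`, when the
`EB`-centered part of `R` comes from alternating products in `P` and `B`. -/
lemma alt_le_ker_of_free_over_sub {R : Subalgebra ℂ A} (hED : IsCondExp D ED)
    (hEB : IsCondExp B EB) (hDB : D ≤ B) (hDP : D ≤ P) (hBQ : B ≤ Q)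
    (hker : LinearMap.ker EB ≤ LinearMap.ker ED)
    (hcrit : ∀ N : Submodule ℂ A, N * toSubmodule B ≤ LinearMap.ker ED → N ≤ LinearMap.ker EB)
    (hR : centered R EB ≤ toSubmodule B * alt (centered P ED) (centered B ED))
    (hQP : alt (centered Q ED) (centered P ED) ≤ LinearMap.ker ED)
    (hPQ : alt (centered P ED) (centered Q ED) ≤ LinearMap.ker ED) :
    alt (centered Q EB) (centered R EB) ≤ LinearMap.ker EB ∧
      alt (centered R EB) (centered Q EB) ≤ LinearMap.ker EB := by
  set V' := centered P ED
  set U' := centered Q ED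
  set U := centered Q EB
  set V := centered R EB
  set B' := centered B ED
  set C := alt V' U'
  set N := U ⊔ U * C with hN
  have hUU' : U ≤ U' := inf_le_inf_left _ hker
  have hBU : toSubmodule B * U ≤ U := toSubmodule_mul_centered_le hEB hBQ
  have hUB : U * toSubmodule B ≤ U := centered_mul_toSubmodule_le hEB hBQ
  have hCB : C * toSubmodule B ≤ C := alt_centered_mul_le hED hDB hDP hBQ
  have hNC : N ≤ alt U' V' :=
    sup_le (hUU'.trans (le_alt _ _)) ((mul_le_mul' hUU' le_rfl).trans (mul_alt_le _ _))
  have hBN : toSubmodule B * N ≤ N := by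
    rw [hN, Submodule.mul_sup, ← mul_assoc]
    exact sup_le_sup hBU (mul_le_mul' hBU le_rfl)
  have hNB : N * toSubmodule B ≤ N := by
    rw [hN, Submodule.sup_mul, mul_assoc]
    exact sup_le_sup hUB (mul_le_mul' le_rfl hCB)
  have hB'B : B' ≤ toSubmodule B := inf_le_left
  have hB'U' : B' ≤ U' := inf_le_inf_right _ hBQ
  have hJN : alt V' B' * N ≤ C :=
    alt_mul_le (T := alt U' V') ((mul_le_mul' le_rfl hNC).trans (mul_alt_le _ _))
      (((mul_le_mul' hB'B le_rfl).trans hBN).trans hNC) (mul_alt_le _ _)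
      ((mul_le_mul' hB'U' le_rfl).trans (mul_alt_le _ _))
  have hJC : alt V' B' ≤ C :=
    alt_le (T := alt U' V') (le_alt _ _) (hB'U'.trans (le_alt _ _)) (mul_alt_le _ _)
      ((mul_le_mul' hB'U' le_rfl).trans (mul_alt_le _ _))
  have hVC : V ≤ toSubmodule B * C := hR.trans (mul_le_mul' le_rfl hJC)
  have hVN : V * N ≤ toSubmodule B * C := by
    refine (mul_le_mul' hR le_rfl).trans ?_
    rw [mul_assoc]
    exact mul_le_mul' le_rfl hJN
  have hUC : U * (toSubmodule B * C) ≤ N := by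
    rw [← mul_assoc]
    exact le_sup_of_le_right (mul_le_mul' hUB le_rfl)
  constructor
  · exact (alt_le (S := N) le_sup_left hVC hUC hVN).trans
      (hcrit _ (hNB.trans (hNC.trans hQP)))
  · exact (alt_le (T := N) hVC le_sup_left hVN hUC).trans
      ((mul_le_mul' le_rfl (hcrit _ (hCB.trans hPQ))).trans (toSubmodule_mul_ker_le hEB))

/-- Freeness over `B` of `Q` and `R` gives freeness over `D` of `Q` and `P ≤ R`, when `P` is
free from `B` over `D`. -/
lemma alt_le_ker_of_free_over_sup {R : Subalgebra ℂ A} (hEB : IsCondExp B EB)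
    (hBQ : B ≤ Q) (hBR : B ≤ R) (hPR : P ≤ R)
    (hker : LinearMap.ker EB ≤ LinearMap.ker ED)
    (hJB : alt (centered P ED) (centered B ED) ≤ LinearMap.ker EB)
    (hJ : alt (centered B ED) (centered P ED) ≤ LinearMap.ker ED)
    (hQR : alt (centered Q EB) (centered R EB) ≤ LinearMap.ker EB)
    (hRQ : alt (centered R EB) (centered Q EB) ≤ LinearMap.ker EB) :
    alt (centered Q ED) (centered P ED) ≤ LinearMap.ker ED ∧
      alt (centered P ED) (centered Q ED) ≤ LinearMap.ker ED := by
  set V' := centered P ED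
  set U' := centered Q ED
  set U := centered Q EB
  set V := centered R EB
  set B' := centered B ED
  set J := alt V' B'
  set H := alt U V
  have hU' : U' ≤ U ⊔ B' := by
    rintro x ⟨hx, hx0⟩
    have hE := hEB.2.1 x
    have hc : x - EB x ∈ U := ⟨Q.sub_mem hx (hBQ hE), by
      change EB (x - EB x) = 0
      rw [map_sub, hEB.map_mem hE, sub_self]⟩
    refine sub_add_cancel x (EB x) ▸ Submodule.add_mem_sup hc ⟨hE, ?_⟩
    simpa using Submodule.sub_mem _ hx0 (hker hc.2)
  have hJV : J ≤ V := by
    refine le_inf (alt_le (T := toSubmodule R) (le_trans inf_le_left hPR)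
      (le_trans inf_le_left hBR) ?_ ?_) hJB
    · exact Submodule.mul_le.2 fun x hx y hy => R.mul_mem (hPR hx.1) hy
    · exact Submodule.mul_le.2 fun x hx y hy => R.mul_mem (hBR hx.1) hy
  have hJH : J * H ≤ LinearMap.ker EB :=
    (mul_le_mul' hJV le_rfl).trans ((mul_alt_le _ _).trans hRQ)
  have hB'B : B' ≤ toSubmodule B := inf_le_left
  have hUJ : U * J ≤ H :=
    (mul_le_mul' le_rfl (hJV.trans (le_alt _ _))).trans (mul_alt_le _ _)
  have hUJH : U * (J * H) ≤ H :=
    (mul_le_mul' le_rfl ((mul_le_mul' hJV le_rfl).trans (mul_alt_le _ _))).trans (mul_alt_le _ _)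
  set S := J ⊔ J * H with hS
  set T := alt B' V' ⊔ (H ⊔ B' * (J * H)) with hT
  have hV'S : V' ≤ S := (le_alt _ _).trans le_sup_left
  have hU'T : U' ≤ T :=
    hU'.trans (sup_le ((le_alt _ _).trans (le_sup_left.trans le_sup_right))
      ((le_alt _ _).trans le_sup_left))
  have hV'T : V' * T ≤ S := by
    rw [hT, Submodule.mul_sup, Submodule.mul_sup, ← mul_assoc, ← mul_assoc, mul_assoc V' B' J]
    exact sup_le_sup (mul_alt_le _ _) (sup_le (mul_le_mul' (le_alt _ _) le_rfl)
      (mul_le_mul' ((mul_le_mul' le_rfl (mul_alt_le _ _)).trans (mul_alt_le _ _)) le_rfl))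
  have hU'S : U' * S ≤ T := by
    refine (mul_le_mul' hU' le_rfl).trans ?_
    rw [Submodule.sup_mul, hS, Submodule.mul_sup, Submodule.mul_sup]
    refine sup_le ((sup_le hUJ hUJH).trans (le_sup_left.trans le_sup_right)) ?_
    exact sup_le_sup (mul_alt_le _ _) le_sup_right
  constructor
  · refine (alt_le hU'T hV'S hU'S hV'T).trans (sup_le hJ (sup_le (hQR.trans hker) ?_))
    exact ((mul_le_mul' hB'B hJH).trans (toSubmodule_mul_ker_le hEB)).trans hker
  · exact (alt_le hV'S hU'T hV'T hU'S).trans (sup_le (hJB.trans hker) (hJH.trans hker))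

end Amalgamation

theorem free_over_B_iff_free_over_D
    (τ : M →ₗ[ℂ] ℂ) (hτ : IsFaithfulTracialState τ)
    (D B : Subalgebra ℂ M) (hDB : D ≤ B)
    (hDstar : ∀ d ∈ D, star d ∈ D) (hBstar : ∀ b ∈ B, star b ∈ B)
    (ED EB : M →ₗ[ℂ] M)
    (hED : IsCondExp D ED) (hEB : IsCondExp B EB)
    (hEDτ : ∀ x, τ (ED x) = τ x) (hEBτ : ∀ x, τ (EB x) = τ x)
    (X Y : M) (hX : IsSelfAdjoint X) (hY : IsSelfAdjoint Y)
    (hYfree : IsFreeWithAmalgamation ED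
      ((D ⊔ Algebra.adjoin ℂ {Y} : Subalgebra ℂ M) : Set M) (B : Set M)) :
    (IsFreeWithAmalgamation EB
        ((B ⊔ Algebra.adjoin ℂ {X} : Subalgebra ℂ M) : Set M)
        ((B ⊔ Algebra.adjoin ℂ {Y} : Subalgebra ℂ M) : Set M) ↔
      IsFreeWithAmalgamation ED
        ((B ⊔ Algebra.adjoin ℂ {X} : Subalgebra ℂ M) : Set M)
        ((D ⊔ Algebra.adjoin ℂ {Y} : Subalgebra ℂ M) : Set M)) := by
  have hker : LinearMap.ker EB ≤ LinearMap.ker ED := fun x hx =>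
    hED.eq_zero hτ hDstar hEDτ fun d hd => by
      have hx0 : EB x = 0 := hx
      rw [← hEBτ, hEB.map_right (hDB hd), hx0, zero_mul, map_zero]
  have hcrit : ∀ N : Submodule ℂ M,
      N * Subalgebra.toSubmodule B ≤ LinearMap.ker ED → N ≤ LinearMap.ker EB :=
    fun N hN x hx => hEB.eq_zero hτ hBstar hEBτ fun b hb => by
      have h0 : ED (x * b) = 0 := hN (Submodule.mul_mem_mul hx hb)
      rw [← hEDτ, h0, map_zero]
  have hDP : D ≤ D ⊔ Algebra.adjoin ℂ {Y} := le_sup_left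
  have hY' : Y ∈ D ⊔ Algebra.adjoin ℂ {Y} :=
    (le_sup_right : _ ≤ D ⊔ Algebra.adjoin ℂ {Y}) (Algebra.self_mem_adjoin_singleton ℂ Y)
  rw [isFreeWithAmalgamation_iff] at hYfree
  have hJ := hcrit _ ((alt_centered_mul_le hED hDB hDP le_rfl).trans hYfree.1)
  rw [isFreeWithAmalgamation_iff, isFreeWithAmalgamation_iff]
  constructor
  · rintro ⟨h₁, h₂⟩
    exact alt_le_ker_of_free_over_sup hEB le_sup_left le_sup_left
      (sup_le_sup_right hDB _) hker hJ hYfree.2 h₁ h₂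
  · rintro ⟨h₁, h₂⟩
    exact alt_le_ker_of_free_over_sub hED hEB hDB hDP le_sup_left hker hcrit
      (centered_sup_adjoin_le hED hEB hDB hDP hY' hJ) h₁ h₂

end OVD
end
end

section
/- Let (M, τ) be a tracial W*-probability space, E: M → B a conditional expectation with τ∘E = τ, and A_1, A_2 subalgebras with B ⊂ A_1, A_2 ⊂ M which are algebraically free modulo B. Then the following are equivalent: (i) A_1 and A_2 are free with amalgamation over B; (ii) the B-valued liberation gradient j_B(A_1:A_2) exists and equals 0. -/
/-!  Statement 11 (Corollary 5.4):  `A₁` and `A₂` are free with amalgamation over `B` iff the `B`-valued liberation gradient `j_B(A₁:A₂)` exists and equals `0`. -/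

open scoped Classical ENNReal

noncomputable section

namespace OVD

variable {M : Type*} [Ring M] [Algebra ℂ M] [StarRing M] [StarModule ℂ M]

/-- the `L²`-distance with respect to the trace `τ`: `‖x − y‖₂`. -/
def l2Dist [StarRing M] (τ : M →ₗ[ℂ] ℂ) (x y : M) : ℝ :=
  Real.sqrt ((τ ((x - y) * star (x - y))).re)

/-- `x` belongs to `L²(S)`, the `‖·‖₂`-closure of the (star-)algebra
generated by `S`, (intersected with `M`; conjugate variables and liberation
gradients are modelled as elements of `M` here). -/
def MemL2Closure [StarRing M] (τ : M →ₗ[ℂ] ℂ) (S : Set M) (x : M) : Prop :=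
  ∀ ε : ℝ, 0 < ε → ∃ a ∈ Algebra.adjoin ℂ (S ∪ star '' S), l2Dist τ x a < ε

/-- the alternating word `c₁c̃₁ c₂c̃₂ ⋯ c_m c̃_m`. -/
def pairWord {m : ℕ} (c c' : Fin m → M) : M :=
  (List.ofFn fun r : Fin m => c r * c' r).prod

/-- the part `c₁c̃₁ ⋯ c_{r-1}c̃_{r-1}` of an alternating word before the
(`0`-indexed) position `r`. -/
def pairWordBefore {m : ℕ} (c c' : Fin m → M) (r : Fin m) : M :=
  (((List.finRange m).filter fun s : Fin m => decide ((s : ℕ) < (r : ℕ))).map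
      fun s => c s * c' s).prod

/-- the part `c_{r+1}c̃_{r+1} ⋯ c_m c̃_m` of an alternating word after the
(`0`-indexed) position `r`. -/
def pairWordAfter {m : ℕ} (c c' : Fin m → M) (r : Fin m) : M :=
  (((List.finRange m).filter fun s : Fin m => decide ((r : ℕ) < (s : ℕ))).map
      fun s => c s * c' s).prod

/-- the defining equations of the liberation gradient `j = j(A₁ : A₂)` with
respect to the conditional expectation `E`, in their explicit form
`E(j c₁c̃₁ ⋯ c_mc̃_m) = ∑_r ( E(c₁c̃₁⋯c̃_{r-1}c_r) E(c̃_r c_{r+1}⋯c_mc̃_m)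
− E(c₁c̃₁⋯c_{r-1}c̃_{r-1}) E(c_rc̃_r⋯c_mc̃_m) )`
(equivalent to `E(ja) = (E ⊗ E)(δ_{A₁:A₂} a)` for all `a ∈ A₁ ∨ A₂`). -/
def LiberationEquations {W : Type*} [Ring W] [Algebra ℂ W] (E : M →ₗ[ℂ] W)
    (S₁ S₂ : Set M) (j : M) : Prop :=
  ∀ (m : ℕ) (c c' : Fin m → M), (∀ r, c r ∈ S₁) → (∀ r, c' r ∈ S₂) →
    E (j * pairWord c c') =
      ∑ r : Fin m,
        (E (pairWordBefore c c' r * c r) * E (c' r * pairWordAfter c c' r) -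
          E (pairWordBefore c c' r) * E (c r * c' r * pairWordAfter c c' r))

/-- `j` is the liberation gradient `j_B(A₁ : A₂)` (for `E : M → B ⊆ M`), resp.
`j_ℂ(A₁ : A₂)` (for `E = τ : M → ℂ`):  it lies in `L²(A₁, A₂)` and satisfies
the defining equations `E(ja) = (E ⊗ E)(δ_{A₁:A₂} a)`. -/
def IsLiberationGradient [StarRing M] (τ : M →ₗ[ℂ] ℂ) {W : Type*} [Ring W]
    [Algebra ℂ W] (E : M →ₗ[ℂ] W) (S₁ S₂ : Set M) (j : M) : Prop :=
  MemL2Closure τ (S₁ ∪ S₂) j ∧ LiberationEquations E S₁ S₂ j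

/-- the relative commutant `B′ ∩ M`. -/
def relativeCommutant (B : Subalgebra ℂ M) : Set M :=
  {x : M | ∀ b ∈ B, b * x = x * b}

/-- the canonical evaluation map from the free algebra on (the disjoint union
of) `A₁` and `A₂` to `M`. -/
def freeWordMap (A₁ A₂ : Subalgebra ℂ M) : FreeAlgebra ℂ (↥A₁ ⊕ ↥A₂) →ₐ[ℂ] M :=
  FreeAlgebra.lift ℂ (Sum.elim (fun a : ↥A₁ => (a : M)) (fun a : ↥A₂ => (a : M)))

/-- the defining relations of the amalgamated free product `A₁ *_B A₂`
inside the free algebra on `A₁ ⊕ A₂`. -/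
def freeProductRelations (B A₁ A₂ : Subalgebra ℂ M) (h₁ : B ≤ A₁) (h₂ : B ≤ A₂) :
    Set (FreeAlgebra ℂ (↥A₁ ⊕ ↥A₂)) :=
  {x | (∃ a a' : ↥A₁, x = FreeAlgebra.ι ℂ (Sum.inl (a * a')) -
          FreeAlgebra.ι ℂ (Sum.inl a) * FreeAlgebra.ι ℂ (Sum.inl a')) ∨
       (∃ a a' : ↥A₁, x = FreeAlgebra.ι ℂ (Sum.inl (a + a')) -
          FreeAlgebra.ι ℂ (Sum.inl a) - FreeAlgebra.ι ℂ (Sum.inl a')) ∨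
       (∃ (z : ℂ) (a : ↥A₁), x = FreeAlgebra.ι ℂ (Sum.inl (z • a)) -
          z • FreeAlgebra.ι ℂ (Sum.inl a)) ∨
       (∃ a a' : ↥A₂, x = FreeAlgebra.ι ℂ (Sum.inr (a * a')) -
          FreeAlgebra.ι ℂ (Sum.inr a) * FreeAlgebra.ι ℂ (Sum.inr a')) ∨
       (∃ a a' : ↥A₂, x = FreeAlgebra.ι ℂ (Sum.inr (a + a')) -
          FreeAlgebra.ι ℂ (Sum.inr a) - FreeAlgebra.ι ℂ (Sum.inr a')) ∨
       (∃ (z : ℂ) (a : ↥A₂), x = FreeAlgebra.ι ℂ (Sum.inr (z • a)) -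
          z • FreeAlgebra.ι ℂ (Sum.inr a)) ∨
       (x = FreeAlgebra.ι ℂ (Sum.inl (1 : ↥A₁)) - 1) ∨
       (x = FreeAlgebra.ι ℂ (Sum.inr (1 : ↥A₂)) - 1) ∨
       (∃ b : ↥B, x = FreeAlgebra.ι ℂ (Sum.inl (⟨(b : M), h₁ b.2⟩ : ↥A₁)) -
          FreeAlgebra.ι ℂ (Sum.inr (⟨(b : M), h₂ b.2⟩ : ↥A₂)))}

/-- `A₁` and `A₂` are algebraically free modulo `B`:  the canonical
homomorphism `A₁ *_B A₂ → A₁ ∨ A₂ ⊆ M` has trivial kernel, i.e. every element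
of the free algebra on `A₁ ⊕ A₂` which maps to `0` in `M` already lies in the
two-sided ideal of defining relations of `A₁ *_B A₂`. -/
def AlgebraicallyFreeModulo (B A₁ A₂ : Subalgebra ℂ M) (h₁ : B ≤ A₁)
    (h₂ : B ≤ A₂) : Prop :=
  ∀ x : FreeAlgebra ℂ (↥A₁ ⊕ ↥A₂), freeWordMap A₁ A₂ x = 0 →
    x ∈ TwoSidedIdeal.span (freeProductRelations B A₁ A₂ h₁ h₂)

/-- The coloured word `c₁c̃₁ ⋯ c_mc̃_m` of a list of pairs. -/
def pairList {S : Type*} (L : List (S × S)) : List (Bool × S) :=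
  L.flatMap fun p => [(true, p.1), (false, p.2)]

@[simp] theorem pairList_nil {S : Type*} : pairList ([] : List (S × S)) = [] := rfl

@[simp] theorem pairList_cons {S : Type*} (p : S × S) (L : List (S × S)) :
    pairList (p :: L) = (true, p.1) :: (false, p.2) :: pairList L := by simp [pairList]

section Words

variable {R : Type*} [Ring R]

/-- The product of the letters of a coloured word. -/
def wordProd (l : List (Bool × R)) : R := (l.map Prod.snd).prod

@[simp] theorem wordProd_nil : wordProd ([] : List (Bool × R)) = 1 := rfl

@[simp] theorem wordProd_cons (p : Bool × R) (l : List (Bool × R)) :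
    wordProd (p :: l) = p.2 * wordProd l := by simp [wordProd]

@[simp] theorem wordProd_append (l l' : List (Bool × R)) :
    wordProd (l ++ l') = wordProd l * wordProd l' := by simp [wordProd]

theorem pairWord_succ {m : ℕ} (c c' : Fin (m + 1) → R) :
    pairWord c c' = c 0 * c' 0 * pairWord (fun r => c r.succ) (fun r => c' r.succ) := by
  simp [pairWord, List.ofFn_succ]

theorem pairWordBefore_zero {m : ℕ} (c c' : Fin (m + 1) → R) : pairWordBefore c c' 0 = 1 := by
  simp [pairWordBefore]

theorem pairWordBefore_succ {m : ℕ} (c c' : Fin (m + 1) → R) (r : Fin m) :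
    pairWordBefore c c' r.succ =
      c 0 * c' 0 * pairWordBefore (fun r => c r.succ) (fun r => c' r.succ) r := by
  simp [pairWordBefore, List.finRange_succ, List.filter_map, Function.comp_def]

theorem pairWordAfter_zero {m : ℕ} (c c' : Fin (m + 1) → R) :
    pairWordAfter c c' 0 = pairWord (fun r => c r.succ) (fun r => c' r.succ) := by
  simp [pairWordAfter, pairWord, List.finRange_succ, List.filter_map, Function.comp_def,
    List.ofFn_eq_map]

theorem pairWordAfter_succ {m : ℕ} (c c' : Fin (m + 1) → R) (r : Fin m) :
    pairWordAfter c c' r.succ = pairWordAfter (fun r => c r.succ) (fun r => c' r.succ) r := by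
  simp [pairWordAfter, List.finRange_succ, List.filter_map, Function.comp_def]

theorem wordProd_pairList_ofFn {m : ℕ} (c c' : Fin m → R) :
    wordProd (pairList (List.ofFn fun r => (c r, c' r))) = pairWord c c' := by
  induction m with
  | zero => simp [pairWord]
  | succ m ih => simp [List.ofFn_succ, pairWord_succ, ih, mul_assoc]

end Words

section Helpers

variable {R : Type*} [Ring R] [Algebra ℂ R]

/-- The subalgebra selected by a colour. -/
def side (A₁ A₂ : Subalgebra ℂ R) (c : Bool) : Subalgebra ℂ R := if c then A₁ else A₂

/-- The contribution of the letters of the coloured word `l` to `(E ⊗ E) (δ (u * wordProd l))`. -/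
def derivSum (E : R →ₗ[ℂ] R) : R → List (Bool × R) → R
  | _, [] => 0
  | u, (true, a) :: l =>
      E (u * a) * E (wordProd l) - E u * E (a * wordProd l) + derivSum E (u * a) l
  | u, (false, a) :: l => derivSum E (u * a) l

theorem derivSum_add (E : R →ₗ[ℂ] R) (u v : R) (l : List (Bool × R)) :
    derivSum E (u + v) l = derivSum E u l + derivSum E v l := by
  induction l generalizing u v with
  | nil => simp [derivSum]
  | cons p l ih =>
    obtain ⟨c, a⟩ := p
    cases c
    · simp [derivSum, add_mul, ih]
    · simp only [derivSum, add_mul, ih, map_add]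
      abel

theorem IsCondExp.map_mul_left {B : Subalgebra ℂ R} {E : R →ₗ[ℂ] R} (hE : IsCondExp B E)
    {b : R} (hb : b ∈ B) (x : R) : E (b * x) = b * E x := by
  simpa using hE.2.2 b hb 1 B.one_mem x

theorem IsCondExp.map_mul_right {B : Subalgebra ℂ R} {E : R →ₗ[ℂ] R} (hE : IsCondExp B E)
    {b : R} (hb : b ∈ B) (x : R) : E (x * b) = E x * b := by
  simpa using hE.2.2 1 B.one_mem b hb x

theorem IsCondExp.map_of_mem {B : Subalgebra ℂ R} {E : R →ₗ[ℂ] R} (hE : IsCondExp B E)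
    {b : R} (hb : b ∈ B) : E b = b := by
  simpa [hE.1] using hE.map_mul_left hb 1

theorem IsCondExp.map_sub_self {B : Subalgebra ℂ R} {E : R →ₗ[ℂ] R} (hE : IsCondExp B E)
    (x : R) : E (x - E x) = 0 := by
  rw [map_sub, hE.map_of_mem (hE.2.1 x), sub_self]

theorem derivSum_mul_left {B : Subalgebra ℂ R} {E : R →ₗ[ℂ] R} (hE : IsCondExp B E)
    {b : R} (hb : b ∈ B) (u : R) (l : List (Bool × R)) :
    derivSum E (b * u) l = b * derivSum E u l := by
  induction l generalizing u with
  | nil => simp [derivSum]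
  | cons p l ih =>
    obtain ⟨c, a⟩ := p
    cases c
    · simp [derivSum, mul_assoc, ih]
    · simp only [derivSum, mul_assoc, ih, hE.map_mul_left hb, mul_add, mul_sub]

theorem le_side {B A₁ A₂ : Subalgebra ℂ R} (h₁ : B ≤ A₁) (h₂ : B ≤ A₂) (c : Bool) :
    B ≤ side A₁ A₂ c := by
  cases c <;> simpa [side]

/-- `AltWord E A₁ A₂ h c u`: the element `u` is a nonempty alternating product of centred elements
whose first factor has colour `h` and whose last factor has colour `c`. -/
inductive AltWord (E : R →ₗ[ℂ] R) (A₁ A₂ : Subalgebra ℂ R) (h : Bool) : Bool → R → Prop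
  | single {x : R} (hx : x ∈ side A₁ A₂ h) (h₀ : E x = 0) : AltWord E A₁ A₂ h h x
  | snoc {c c' : Bool} {u x : R} (hu : AltWord E A₁ A₂ h c u) (hc : c ≠ c')
      (hx : x ∈ side A₁ A₂ c') (h₀ : E x = 0) : AltWord E A₁ A₂ h c' (u * x)

theorem AltWord.mul_right {B A₁ A₂ : Subalgebra ℂ R} {E : R →ₗ[ℂ] R} (hE : IsCondExp B E)
    (h₁ : B ≤ A₁) (h₂ : B ≤ A₂) {h c : Bool} {u b : R} (hu : AltWord E A₁ A₂ h c u)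
    (hb : b ∈ B) : AltWord E A₁ A₂ h c (u * b) := by
  cases hu with
  | single hx h₀ =>
    exact .single (mul_mem hx (le_side h₁ h₂ _ hb)) (by rw [hE.map_mul_right hb, h₀, zero_mul])
  | snoc hu hc hx h₀ =>
    rw [mul_assoc]
    exact .snoc hu hc (mul_mem hx (le_side h₁ h₂ _ hb))
      (by rw [hE.map_mul_right hb, h₀, zero_mul])

/-- Coloured lists of centred elements with alternating colours. -/
def IsAlt (E : R →ₗ[ℂ] R) (A₁ A₂ : Subalgebra ℂ R) (l : List (Bool × R)) : Prop :=
  l.IsChain (fun p q => p.1 ≠ q.1) ∧ ∀ p ∈ l, p.2 ∈ side A₁ A₂ p.1 ∧ E p.2 = 0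

theorem AltWord.exists_list {A₁ A₂ : Subalgebra ℂ R} {E : R →ₗ[ℂ] R} {h c : Bool} {u : R}
    (hu : AltWord E A₁ A₂ h c u) :
    ∃ (l : List (Bool × R)) (x : R), IsAlt E A₁ A₂ (l ++ [(c, x)]) ∧
      wordProd (l ++ [(c, x)]) = u := by
  induction hu with
  | @single x hx h₀ => exact ⟨[], x, by simp [IsAlt, hx, h₀], by simp⟩
  | @snoc c c' u y hu hc hy h₀ ih =>
    obtain ⟨l, x, ⟨hch, hl⟩, rfl⟩ := ih
    refine ⟨l ++ [(c, x)], y, ⟨?_, ?_⟩, by simp [mul_assoc]⟩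
    · rw [List.isChain_append]
      exact ⟨hch, by simp, by simpa using hc⟩
    · intro p hp
      rcases List.mem_append.1 hp with hp | hp
      · exact hl p hp
      · obtain rfl := List.mem_singleton.1 hp
        exact ⟨hy, h₀⟩

theorem isFreeWithAmalgamation_iff_s11 {E : R →ₗ[ℂ] R} {A₁ A₂ : Subalgebra ℂ R} :
    IsFreeWithAmalgamation E (A₁ : Set R) (A₂ : Set R) ↔
      ∀ l, l ≠ [] → IsAlt E A₁ A₂ l → E (wordProd l) = 0 := by
  constructor
  · intro hfree l hl halt
    have := hfree l.length (List.length_pos_iff.2 hl) (fun j => (l.get j).2)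
      (fun j => (l.get j).1) (fun j => ?_) (fun j => (halt.2 _ (l.get_mem j)).2) ?_
    · rwa [show (List.ofFn fun j => (l.get j).2) = l.map Prod.snd by
        rw [← Function.comp_def Prod.snd l.get, ← List.map_ofFn, List.ofFn_get]] at this
    · have := (halt.2 _ (l.get_mem j)).1
      rw [side] at this
      split_ifs at this ⊢ <;> exact this
    · intro j hj
      exact List.isChain_iff_getElem.1 halt.1 j hj
  · intro h k hk a f ha h₀ hf
    have := h (List.ofFn fun j => (f j, a j)) (by simpa using hk.ne') ⟨?_, ?_⟩
    · simpa [wordProd, List.map_ofFn, Function.comp_def] using this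
    · rw [List.isChain_iff_getElem]
      intro j hj
      simpa using hf j (by simpa using hj)
    · intro p hp
      obtain ⟨j, rfl⟩ := (List.mem_ofFn' _ _).1 hp
      refine ⟨?_, h₀ j⟩
      have := ha j
      cases hc : f j <;> simpa [side, hc] using this

section Forward

variable {B A₁ A₂ : Subalgebra ℂ R} {E : R →ₗ[ℂ] R}

theorem derivSum_altWord_mul (hE : IsCondExp B E) (h₁ : B ≤ A₁) (h₂ : B ≤ A₂)
    {l : List (Bool × R)}
    (ih : ∀ h c u, AltWord E A₁ A₂ h c u → derivSum E u l = if h then E (u * wordProd l) else 0)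
    {h c c' : Bool} {u y : R} (hu : AltWord E A₁ A₂ h c u) (hc : c ≠ c')
    (hy : y ∈ side A₁ A₂ c') :
    derivSum E (u * y) l = if h then E (u * y * wordProd l) else 0 := by
  have hy₀ : AltWord E A₁ A₂ h c' (u * (y - E y)) :=
    .snoc hu hc (sub_mem hy (le_side h₁ h₂ _ (hE.2.1 y))) (hE.map_sub_self y)
  have hsplit : u * y = u * (y - E y) + u * E y := by rw [← mul_add, sub_add_cancel]
  rw [hsplit, derivSum_add, ih _ _ _ hy₀, ih _ _ _ (hu.mul_right hE h₁ h₂ (hE.2.1 y))]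
  cases h
  · simp
  · simp only [if_true, add_mul, map_add]

theorem derivSum_letter (hE : IsCondExp B E) (h₁ : B ≤ A₁) (h₂ : B ≤ A₂)
    {l : List (Bool × R)} (ih₁ : derivSum E 1 l = 0)
    (ih : ∀ h c u, AltWord E A₁ A₂ h c u → derivSum E u l = if h then E (u * wordProd l) else 0)
    {c : Bool} {y : R} (hy : y ∈ side A₁ A₂ c) :
    derivSum E y l = if c then E (y * wordProd l) - E y * E (wordProd l) else 0 := by
  have hy₀ : AltWord E A₁ A₂ c c (y - E y) :=
    .single (sub_mem hy (le_side h₁ h₂ _ (hE.2.1 y))) (hE.map_sub_self y)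
  have hsplit : derivSum E y l = derivSum E ((y - E y) + E y * 1) l := by
    rw [mul_one, sub_add_cancel]
  rw [hsplit, derivSum_add, ih _ _ _ hy₀, derivSum_mul_left hE (hE.2.1 y), ih₁, mul_zero, add_zero,
    sub_mul, map_sub, hE.map_mul_left (hE.2.1 y)]

theorem map_altWord_mul (hE : IsCondExp B E) (h₁ : B ≤ A₁) (h₂ : B ≤ A₂)
    (hfree : ∀ h c u, AltWord E A₁ A₂ h c u → E u = 0)
    {h c c' : Bool} {u y : R} (hu : AltWord E A₁ A₂ h c u) (hc : c ≠ c')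
    (hy : y ∈ side A₁ A₂ c') : E (u * y) = 0 := by
  have hsplit : u * y = u * (y - E y) + u * E y := by rw [← mul_add, sub_add_cancel]
  rw [hsplit, map_add, hE.map_mul_right (hE.2.1 y), hfree _ _ _ hu, zero_mul, add_zero]
  exact hfree _ _ _
    (.snoc hu hc (sub_mem hy (le_side h₁ h₂ _ (hE.2.1 y))) (hE.map_sub_self y))

theorem derivSum_of_free (hE : IsCondExp B E) (h₁ : B ≤ A₁) (h₂ : B ≤ A₂)
    (hfree : ∀ h c u, AltWord E A₁ A₂ h c u → E u = 0) (l : List (Bool × R))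
    (hl : ∀ p ∈ l, p.2 ∈ side A₁ A₂ p.1) :
    derivSum E 1 l = 0 ∧ ∀ h c u, AltWord E A₁ A₂ h c u →
      derivSum E u l = if h then E (u * wordProd l) else 0 := by
  induction l with
  | nil =>
    refine ⟨rfl, fun h c u hu => ?_⟩
    simp [derivSum, hfree _ _ _ hu]
  | cons p l ihl =>
    obtain ⟨c', a⟩ := p
    have ha : a ∈ side A₁ A₂ c' := hl (c', a) (by simp)
    obtain ⟨ih₁, ih⟩ := ihl fun p hp => hl p (List.mem_cons_of_mem _ hp)
    refine ⟨?_, fun h c u hu => ?_⟩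
    · have := derivSum_letter hE h₁ h₂ ih₁ ih ha
      cases c' <;> simp [derivSum, this, hE.1]
    · have hstep : derivSum E u ((c', a) :: l) =
          (if c' then E (u * a) * E (wordProd l) else 0) + derivSum E (u * a) l := by
        cases c' <;> simp [derivSum, hfree _ _ _ hu]
      rw [hstep, wordProd_cons, ← mul_assoc]
      by_cases hc : c = c'
      · subst hc
        cases hu with
        | single hx h₀ =>
          rw [derivSum_letter hE h₁ h₂ ih₁ ih (mul_mem hx ha)]
          cases h <;> simp
        | snoc hu hc hx h₀ =>
          have hxa := mul_mem hx ha
          rw [mul_assoc, map_altWord_mul hE h₁ h₂ hfree hu hc hxa,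
            derivSum_altWord_mul hE h₁ h₂ ih hu hc hxa]
          simp
      · rw [map_altWord_mul hE h₁ h₂ hfree hu hc ha, derivSum_altWord_mul hE h₁ h₂ ih hu hc ha]
        simp

end Forward

section PairWords

theorem sum_eq_derivSum (E : R →ₗ[ℂ] R) {m : ℕ} (c c' : Fin m → R) (u : R) :
    ∑ r : Fin m, (E (u * (pairWordBefore c c' r * c r)) * E (c' r * pairWordAfter c c' r) -
        E (u * pairWordBefore c c' r) * E (c r * c' r * pairWordAfter c c' r)) =
      derivSum E u (pairList (List.ofFn fun r => (c r, c' r))) := by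
  induction m generalizing u with
  | zero => simp [derivSum]
  | succ m ih =>
    rw [Fin.sum_univ_succ]
    simp only [pairWordBefore_zero, pairWordBefore_succ, pairWordAfter_zero, pairWordAfter_succ,
      List.ofFn_succ, pairList_cons, derivSum, wordProd_cons, wordProd_pairList_ofFn, ← ih,
      one_mul, mul_one, mul_assoc]

theorem liberationEquations_zero_iff (E : R →ₗ[ℂ] R) (A₁ A₂ : Subalgebra ℂ R) :
    LiberationEquations E (A₁ : Set R) (A₂ : Set R) 0 ↔
      ∀ L : List (R × R), (∀ p ∈ L, p.1 ∈ A₁ ∧ p.2 ∈ A₂) → derivSum E 1 (pairList L) = 0 := by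
  have key {m : ℕ} (c c' : Fin m → R) := sum_eq_derivSum E c c' 1
  simp only [one_mul] at key
  constructor
  · intro h L hL
    have := h L.length (fun r => (L.get r).1) (fun r => (L.get r).2)
      (fun r => (hL _ (L.get_mem r)).1) (fun r => (hL _ (L.get_mem r)).2)
    rw [key, zero_mul, map_zero] at this
    simpa using this.symm
  · intro h m c c' hc hc'
    rw [key, h, zero_mul, map_zero]
    intro p hp
    obtain ⟨r, rfl⟩ := (List.mem_ofFn' _ _).1 hp
    exact ⟨hc r, hc' r⟩

end PairWords

section Backward

variable {B A₁ A₂ : Subalgebra ℂ R} {E : R →ₗ[ℂ] R}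

theorem IsAlt.mono {l l' : List (Bool × R)} (h : IsAlt E A₁ A₂ l) (hl : l' <:+: l) :
    IsAlt E A₁ A₂ l' :=
  ⟨by
    obtain ⟨s, t, rfl⟩ := hl
    exact h.1.left_of_append.right_of_append, fun p hp => h.2 p (hl.subset hp)⟩

theorem IsAlt.cons {p q : Bool × R} {l : List (Bool × R)} (h : IsAlt E A₁ A₂ (q :: l))
    (hpq : p.1 ≠ q.1) (hp : p.2 ∈ side A₁ A₂ p.1) (h₀ : E p.2 = 0) :
    IsAlt E A₁ A₂ (p :: q :: l) := by
  refine ⟨List.isChain_cons_cons.2 ⟨hpq, h.1⟩, fun r hr => ?_⟩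
  rcases List.mem_cons.1 hr with rfl | hr
  · exact ⟨hp, h₀⟩
  · exact h.2 r hr

theorem IsAlt.exists_pairList : ∀ l : List (Bool × R), IsAlt E A₁ A₂ l →
    (∀ p ∈ l.head?, p.1 = true) → (∀ p ∈ l.getLast?, p.1 = false) →
    ∃ L : List (R × R), l = pairList L ∧ ∀ p ∈ L, p.1 ∈ A₁ ∧ p.2 ∈ A₂
  | [], _, _, _ => ⟨[], rfl, by simp⟩
  | [p], _, hh, hl => by simp_all
  | (c, x) :: (c', y) :: l, hal, hh, hl => by
    obtain rfl : c = true := hh (c, x) (by simp)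
    have hch := List.isChain_cons_cons.1 hal.1
    obtain rfl : c' = false := by simpa using hch.1
    obtain ⟨L, rfl, hL⟩ := IsAlt.exists_pairList l
      (hal.mono ((List.suffix_cons _ _).trans (List.suffix_cons _ _)).isInfix)
      (fun p hp => by
        have := (List.isChain_cons.1 hch.2).1 p hp
        simpa using this.symm)
      (fun p hp => hl p (by
        rw [List.getLast?_cons_cons, List.getLast?_cons, Option.mem_def.1 hp]; simp))
    refine ⟨(x, y) :: L, by simp, fun p hp => ?_⟩
    rcases List.mem_cons.1 hp with rfl | hp
    · exact ⟨(hal.2 (true, x) (by simp)).1, (hal.2 (false, y) (by simp)).1⟩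
    · exact hL p hp

theorem derivSum_append_eq_zero (u a : R) (l : List (Bool × R))
    (h : ∀ q, q <+: l → E (u * wordProd q) = 0) : derivSum E u (l ++ [(false, a)]) = 0 := by
  induction l generalizing u with
  | nil => simp [derivSum]
  | cons p l ih =>
    have hu : E u = 0 := by simpa using h [] ⟨_, rfl⟩
    have hua : E (u * p.2) = 0 := by simpa using h [p] (by simp)
    have := ih (u * p.2) fun q hq => by
      simpa [mul_assoc] using h (p :: q) (by simpa using hq)
    obtain ⟨c, x⟩ := p
    cases c <;> simp_all [derivSum]

theorem map_wordProd_eq_zero_of_liberation (hE₁ : E 1 = 1)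
    (hlib : LiberationEquations E (A₁ : Set R) (A₂ : Set R) 0) (x y : R) (l : List (Bool × R))
    (hal : IsAlt E A₁ A₂ ((true, x) :: l ++ [(false, y)]))
    (hshort : ∀ q, q <+: l → E (wordProd ((true, x) :: q)) = 0) :
    E (wordProd ((true, x) :: l ++ [(false, y)])) = 0 := by
  obtain ⟨L, hL, hmem⟩ := IsAlt.exists_pairList _ hal (by simp) (by
    intro p hp
    rw [List.getLast?_concat] at hp
    simp at hp
    simp [← hp])
  have h0 := (liberationEquations_zero_iff E A₁ A₂).1 hlib L hmem
  have hx : E x = 0 := (hal.2 (true, x) (by simp)).2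
  have hd := derivSum_append_eq_zero (E := E) x y l (by simpa using hshort)
  rw [← hL] at h0
  simp only [List.cons_append, derivSum, one_mul, hE₁, hx, hd, zero_mul, zero_sub, add_zero,
    neg_eq_zero] at h0
  simpa using h0

end Backward

end Helpers

section Trace

variable {R : Type*} [Ring R] [Algebra ℂ R] [StarRing R]

theorem IsCondExp.eq_zero_of_forall_trace {B : Subalgebra ℂ R} {E : R →ₗ[ℂ] R}
    {τ : R →ₗ[ℂ] ℂ} (hτ : IsFaithfulTracialState τ) (hE : IsCondExp B E)
    (hEτ : ∀ x, τ (E x) = τ x) {w : R} (hw : ∀ b ∈ B, τ (w * b) = 0) : E w = 0 := by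
  apply hτ.faithful
  have hb := hE.2.1 (star (E w))
  rw [← hEτ, hE.map_mul_right (hE.2.1 w), ← hE.map_mul_left hb, hEτ, hτ.tracial, hw _ hb]

theorem isFree_of_liberationEquations {B A₁ A₂ : Subalgebra ℂ R} {E : R →ₗ[ℂ] R}
    {τ : R →ₗ[ℂ] ℂ} (hτ : IsFaithfulTracialState τ) (h₁ : B ≤ A₁) (h₂ : B ≤ A₂)
    (hE : IsCondExp B E) (hEτ : ∀ x, τ (E x) = τ x)
    (hlib : LiberationEquations E (A₁ : Set R) (A₂ : Set R) 0) :
    IsFreeWithAmalgamation E (A₁ : Set R) (A₂ : Set R) := by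
  rw [isFreeWithAmalgamation_iff_s11]
  suffices H : ∀ (n : ℕ) (l : List (Bool × R)), l.length = n → l ≠ [] → IsAlt E A₁ A₂ l →
      E (wordProd l) = 0 from fun l => H _ l rfl
  intro n
  induction n using Nat.strong_induction_on with
  | _ n ih =>
  have halt : ∀ (x y : R) (l : List (Bool × R)), l.length + 2 = n →
      IsAlt E A₁ A₂ ((true, x) :: l ++ [(false, y)]) →
      E (wordProd ((true, x) :: l ++ [(false, y)])) = 0 := by
    intro x y l hn hal
    refine map_wordProd_eq_zero_of_liberation hE.1 hlib x y l hal fun q hq => ?_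
    refine ih _ ?_ _ rfl (by simp) (hal.mono ?_)
    · have := hq.length_le
      simp only [List.length_cons]
      omega
    · exact ((List.prefix_cons_inj _).2 hq).isInfix.trans (List.prefix_append _ _).isInfix
  intro l hn hl hal
  obtain _ | ⟨⟨c, x⟩, l⟩ := l
  · exact absurd rfl hl
  obtain rfl | ⟨l, ⟨c', y⟩, rfl⟩ := List.eq_nil_or_concat' l
  · simpa using (hal.2 _ (List.mem_singleton_self _)).2
  have hx := hal.2 (c, x) (by simp)
  have hy := hal.2 (c', y) (by simp)
  have hn' : l.length + 2 = n := by simpa using hn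
  by_cases hc : c = c'
  · subst hc
    refine hE.eq_zero_of_forall_trace hτ hEτ fun b hb => ?_
    obtain _ | ⟨q, l⟩ := l
    · simpa using hal.1
    have hz : y * b * x ∈ side A₁ A₂ c := mul_mem (mul_mem hy.1 (le_side h₁ h₂ _ hb)) hx.1
    have hmid : IsAlt E A₁ A₂ (q :: l) := hal.mono ⟨[(c, x)], [(c, y)], by simp⟩
    have hcq : c ≠ q.1 := (List.isChain_cons_cons.1 hal.1).1
    have e₁ := ih _ (by simp at hn' ⊢; omega) (q :: l) rfl (by simp) hmid
    have e₂ := ih _ (by simp at hn' ⊢; omega) ((c, y * b * x - E (y * b * x)) :: q :: l) rfl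
      (by simp) (hmid.cons hcq (sub_mem hz (le_side h₁ h₂ _ (hE.2.1 _))) (hE.map_sub_self _))
    have hw : E (y * b * x * wordProd (q :: l)) = 0 := by
      rw [wordProd_cons, sub_mul, map_sub, hE.map_mul_left (hE.2.1 _), e₁, mul_zero,
        sub_zero] at e₂
      exact e₂
    have hcyc : τ (wordProd ((c, x) :: (q :: l ++ [(c, y)])) * b) =
        τ (y * b * x * wordProd (q :: l)) := by
      rw [mul_assoc (y * b), hτ.tracial (y * b)]
      simp [mul_assoc]
    rw [hcyc, ← hEτ, hw, map_zero]
  · cases c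
    · obtain rfl : c' = true := by simpa using hc
      refine hE.eq_zero_of_forall_trace hτ hEτ fun b hb => ?_
      have hcyc : τ (wordProd ((false, x) :: (l ++ [(true, y)])) * b) =
          τ (wordProd ((true, y * b) :: (false, x) :: l)) := by
        simp only [wordProd_cons, wordProd_append, wordProd_nil, mul_one]
        rw [hτ.tracial (y * b)]
        simp [mul_assoc]
      have hmid : IsAlt E A₁ A₂ ((false, x) :: l) := hal.mono ⟨[], [(true, y)], by simp⟩
      have hrot := hmid.cons (p := (true, y * b)) (by simp)
        (mul_mem hy.1 (le_side h₁ h₂ _ hb)) (by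
          simp only [hE.map_mul_right hb]
          rw [show E y = 0 from hy.2, zero_mul])
      have hlast : ∃ (l' : List (Bool × R)) (z : R), (false, x) :: l = l' ++ [(false, z)] := by
        obtain h | ⟨l', ⟨d, z⟩, h⟩ := List.eq_nil_or_concat' ((false, x) :: l)
        · simp at h
        · have hch := hal.1
          rw [← List.cons_append, h, List.isChain_append] at hch
          have : d = false := by simpa using hch.2.2
          exact ⟨l', z, by rw [h, this]⟩
      obtain ⟨l', z, h⟩ := hlast
      rw [h] at hrot hcyc
      have hlen := congrArg List.length h
      simp only [List.length_cons, List.length_append, List.length_nil] at hlen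
      rw [hcyc, ← hEτ, ← List.cons_append, halt _ _ _ (by omega) hrot, map_zero]
    · obtain rfl : c' = false := by simpa using hc
      exact halt x y l hn' hal

theorem memL2Closure_zero (τ : R →ₗ[ℂ] ℂ) (S : Set R) : MemL2Closure τ S 0 :=
  fun ε hε => ⟨0, zero_mem _, by simpa [l2Dist] using hε⟩

end Trace

theorem free_iff_liberation_gradient_zero
    (τ : M →ₗ[ℂ] ℂ) (hτ : IsFaithfulTracialState τ)
    (B A₁ A₂ : Subalgebra ℂ M) (hBA₁ : B ≤ A₁) (hBA₂ : B ≤ A₂)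
    (halgfree : AlgebraicallyFreeModulo B A₁ A₂ hBA₁ hBA₂)
    (E : M →ₗ[ℂ] M) (hE : IsCondExp B E) (hEτ : ∀ x, τ (E x) = τ x) :
    (IsFreeWithAmalgamation E (A₁ : Set M) (A₂ : Set M) ↔
      IsLiberationGradient τ E (A₁ : Set M) (A₂ : Set M) 0) := by
  refine ⟨fun hfree => ⟨memL2Closure_zero τ _, ?_⟩,
    fun h => isFree_of_liberationEquations hτ hBA₁ hBA₂ hE hEτ h.2⟩
  rw [isFreeWithAmalgamation_iff_s11] at hfree
  rw [liberationEquations_zero_iff]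
  intro L hL
  refine (derivSum_of_free hE hBA₁ hBA₂ (fun h c u hu => ?_) _ fun p hp => ?_).1
  · obtain ⟨l, x, hal, rfl⟩ := hu.exists_list
    exact hfree _ (by simp) hal
  · obtain ⟨q, hq, hp⟩ := List.mem_flatMap.1 hp
    have := hL q hq
    simp only [List.mem_cons, List.not_mem_nil, or_false] at hp
    rcases hp with rfl | rfl <;> simp [side, this]

end OVD
end
end
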